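/- arXiv:1004.4872 — 3 statements merged into one kernel-verified Lean document; each statement's English description precedes it below -/
import Mathlib

section
/- Let ℱ be any finite set of positive integers; let 𝒢₂ = {2^t·g : g odd positive, t ≥ 6⌊log₂((g−1)/2)/16⌋ + 2}; let 𝒢₃ = {2^t·g : g odd positive, and t ≥ 2s₂(g) if g ≡ 1 (mod 4), t ≥ 2s₂(g) − 1 if g ≡ 3 (mod 4)}, where s₂(g) denotes the number of ones in the binary expansion of g; and let 𝒬 = {n² : n a positive integer}. Then the multiplicative monoid 𝓜 generated by ℱ ∪ 𝒢₂ ∪ 𝒢₃ ∪ 𝒬 satisfies M(x) = O(x^{8/11+ε}) for every ε > 0. -/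
/-- The counting function of a set of natural numbers:
`count A x = #{n ∈ A : n ≤ x}`. -/
noncomputable def count (A : Set ℕ) (x : ℝ) : ℕ :=
  {n : ℕ | n ∈ A ∧ (n : ℝ) ≤ x}.ncard

/-- `s₂ g` is the number of ones in the binary expansion of `g`. -/
def s₂ (g : ℕ) : ℕ := (Nat.digits 2 g).count 1

/-- Orders `2^t * g`, `g` odd positive, with `t ≥ 6⌊log₂((g-1)/2)/16⌋ + 2`. -/
def G₂ : Set ℕ :=
  {n : ℕ | ∃ g t : ℕ, Odd g ∧ 0 < g ∧
    (t : ℤ) ≥ 6 * ⌊Real.logb 2 (((g : ℝ) - 1) / 2) / 16⌋ + 2 ∧ n = 2 ^ t * g}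

/-- Orders `2^t * g`, `g` odd positive, with `t ≥ 2 s₂ g` when `g ≡ 1 (mod 4)` and
`t ≥ 2 s₂ g - 1` when `g ≡ 3 (mod 4)`. -/
def G₃ : Set ℕ :=
  {n : ℕ | ∃ g t : ℕ, Odd g ∧ 0 < g ∧
    (g % 4 = 1 → t ≥ 2 * s₂ g) ∧ (g % 4 = 3 → t ≥ 2 * s₂ g - 1) ∧ n = 2 ^ t * g}

/-- The positive perfect squares. -/
def Qsq : Set ℕ := {n : ℕ | ∃ m : ℕ, 0 < m ∧ n = m ^ 2}

namespace MonoidCount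

open Finset

/-- The weight `n ^ (-σ)` is multiplicative in `n`. -/
lemma ofReal_rpow_mul (σ : ℝ) (m n : ℕ) :
    ENNReal.ofReal (((m * n : ℕ) : ℝ) ^ (-σ)) =
      ENNReal.ofReal ((m : ℝ) ^ (-σ)) * ENNReal.ofReal ((n : ℝ) ^ (-σ)) := by
  rw [Nat.cast_mul, Real.mul_rpow (Nat.cast_nonneg _) (Nat.cast_nonneg _),
    ENNReal.ofReal_mul (by positivity)]

lemma ofReal_rpow_pow (σ : ℝ) (n k : ℕ) :
    ENNReal.ofReal (((n ^ k : ℕ) : ℝ) ^ (-σ)) = ENNReal.ofReal ((n : ℝ) ^ (-σ)) ^ k := by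
  induction k with
  | zero => simp
  | succ k ih => rw [pow_succ, ofReal_rpow_mul, ih, pow_succ]

/-- Euler product bound for the Dirichlet series of a finitely generated monoid. -/
lemma tsum_closure_le_prod (σ : ℝ) (S : Finset ℕ) :
    ∑' m : (Submonoid.closure (S : Set ℕ) : Set ℕ), ENNReal.ofReal (((m : ℕ) : ℝ) ^ (-σ)) ≤
      ∏ a ∈ S, (1 - ENNReal.ofReal ((a : ℝ) ^ (-σ)))⁻¹ := by
  induction S using Finset.induction_on with
  | empty =>
    have h : ((Submonoid.closure ((∅ : Finset ℕ) : Set ℕ) : Submonoid ℕ) : Set ℕ) = {1} := by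
      rw [Finset.coe_empty, Submonoid.closure_empty, Submonoid.coe_bot]
    rw [h, tsum_singleton (f := fun m : ℕ => ENNReal.ofReal ((m : ℝ) ^ (-σ)))]
    simp
  | insert a S ha ih =>
    rw [Finset.prod_insert ha, ← ENNReal.tsum_geometric]
    let φ : ℕ × (Submonoid.closure (S : Set ℕ) : Set ℕ) →
        (Submonoid.closure ((insert a S : Finset ℕ) : Set ℕ) : Set ℕ) := fun p =>
      ⟨a ^ p.1 * p.2, mul_mem
        (pow_mem (Submonoid.subset_closure (by simp)) _)
        (Submonoid.closure_mono (by simp) p.2.2)⟩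
    have hφ : Function.Surjective φ := by
      rintro ⟨m, hm⟩
      have hm' : m ∈ Submonoid.closure ({a} ∪ (S : Set ℕ)) := by
        rwa [Finset.coe_insert, Set.insert_eq] at hm
      rw [Submonoid.closure_union, Submonoid.mem_sup] at hm'
      obtain ⟨y, hy, z, hz, rfl⟩ := hm'
      obtain ⟨k, rfl⟩ := Submonoid.mem_closure_singleton.1 hy
      exact ⟨⟨k, z, hz⟩, rfl⟩
    calc _ ≤ ∑' p, ENNReal.ofReal (((φ p : ℕ) : ℝ) ^ (-σ)) :=
          ENNReal.tsum_le_tsum_comp_of_surjective hφ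
            (fun m => ENNReal.ofReal (((m : ℕ) : ℝ) ^ (-σ)))
      _ = ∑' p : ℕ × (Submonoid.closure (S : Set ℕ) : Set ℕ),
            ENNReal.ofReal ((a : ℝ) ^ (-σ)) ^ p.1 *
              ENNReal.ofReal (((p.2 : ℕ) : ℝ) ^ (-σ)) := by
          refine tsum_congr fun p => ?_
          rw [← ofReal_rpow_pow, ← ofReal_rpow_mul]
      _ = (∑' k : ℕ, ENNReal.ofReal ((a : ℝ) ^ (-σ)) ^ k) *
            ∑' m : (Submonoid.closure (S : Set ℕ) : Set ℕ),
              ENNReal.ofReal (((m : ℕ) : ℝ) ^ (-σ)) := by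
          rw [ENNReal.tsum_prod']
          simp_rw [ENNReal.tsum_mul_left, ENNReal.tsum_mul_right]
      _ ≤ _ := by gcongr

lemma inv_one_sub_le_exp {u r : ℝ} (hu : 0 ≤ u) (hur : u ≤ r) (hr : r < 1) :
    (1 - u)⁻¹ ≤ Real.exp (u / (1 - r)) := by
  have h1 : 0 < 1 - u := by linarith
  have h2 : 0 < 1 - r := by linarith
  calc (1 - u)⁻¹ = u / (1 - u) + 1 := by field_simp; ring
    _ ≤ Real.exp (u / (1 - u)) := Real.add_one_le_exp _
    _ ≤ _ := by gcongr

lemma prod_inv_one_sub_le {σ : ℝ} (hσ : 0 < σ) (S : Finset ℕ) (hS : ∀ a ∈ S, 2 ≤ a) :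
    ∏ a ∈ S, (1 - ENNReal.ofReal ((a : ℝ) ^ (-σ)))⁻¹ ≤
      ENNReal.ofReal (Real.exp ((∑ a ∈ S, (a : ℝ) ^ (-σ)) / (1 - 2 ^ (-σ)))) := by
  have hr : (2 : ℝ) ^ (-σ) < 1 := Real.rpow_lt_one_of_one_lt_of_neg (by norm_num) (by linarith)
  rw [Finset.sum_div, Real.exp_sum, ENNReal.ofReal_prod_of_nonneg fun _ _ => (Real.exp_pos _).le]
  refine Finset.prod_le_prod' fun a ha => ?_
  have hle : (a : ℝ) ^ (-σ) ≤ 2 ^ (-σ) :=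
    Real.rpow_le_rpow_of_nonpos (by norm_num) (by exact_mod_cast hS a ha) (by linarith)
  have h0 : (0 : ℝ) ≤ (a : ℝ) ^ (-σ) := by positivity
  rw [← ENNReal.ofReal_one, ← ENNReal.ofReal_sub _ h0,
    ← ENNReal.ofReal_inv_of_pos (by linarith)]
  exact ENNReal.ofReal_le_ofReal (inv_one_sub_le_exp h0 hle hr)

/-- An element `≤ N` of a monoid is a product of generators in `[2, N]`. -/
lemma mem_closure_Icc {A : Set ℕ} (hA : ∀ a ∈ A, 0 < a) (N : ℕ) {m : ℕ}
    (hm : m ∈ Submonoid.closure A) :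
    0 < m ∧ (m ≤ N → m ∈ Submonoid.closure (A ∩ Set.Icc 2 N)) := by
  induction hm using Submonoid.closure_induction with
  | mem a ha =>
    refine ⟨hA a ha, fun hN => ?_⟩
    obtain rfl | h := eq_or_ne a 1
    · exact one_mem _
    · exact Submonoid.subset_closure ⟨ha, by have := hA a ha; grind⟩
  | one => exact ⟨one_pos, fun _ => one_mem _⟩
  | mul x y _ _ hx hy =>
    refine ⟨Nat.mul_pos hx.1 hy.1, fun h => mul_mem (hx.2 ?_) (hy.2 ?_)⟩
    · exact (Nat.le_mul_of_pos_right _ hy.1).trans h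
    · exact (Nat.le_mul_of_pos_left _ hx.1).trans h

/-- If `∑_{a ∈ A} a ^ (-σ)` converges, the monoid generated by `A` has counting function
`O(x ^ σ)`. -/
lemma exists_count_closure_le {A : Set ℕ} (hA : ∀ a ∈ A, 0 < a) {σ : ℝ} (hσ : 0 < σ)
    (hsum : Summable (A.indicator fun n : ℕ => (n : ℝ) ^ (-σ))) :
    ∃ c : ℝ, 0 < c ∧ ∀ x : ℝ, 1 ≤ x →
      (count (Submonoid.closure A : Set ℕ) x : ℝ) ≤ c * x ^ σ := by
  classical
  have hr : (2 : ℝ) ^ (-σ) < 1 := Real.rpow_lt_one_of_one_lt_of_neg (by norm_num) (by linarith)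
  set K := ∑' n, A.indicator (fun n : ℕ => (n : ℝ) ^ (-σ)) n
  refine ⟨Real.exp (K / (1 - 2 ^ (-σ))), Real.exp_pos _, fun x hx => ?_⟩
  set N := ⌊x⌋₊
  have hx0 : 0 < x := by linarith
  set S : Finset ℕ := {a ∈ Finset.Icc 2 N | a ∈ A}
  have hS : (S : Set ℕ) = A ∩ Set.Icc 2 N := by
    ext; simp [S]; tauto
  set T : Finset ℕ := {m ∈ Finset.Icc 1 N | m ∈ Submonoid.closure A}
  have hT : {n : ℕ | n ∈ (Submonoid.closure A : Set ℕ) ∧ (n : ℝ) ≤ x} = T := by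
    ext n
    simp only [SetLike.mem_coe, Set.mem_ofPred_eq, Finset.coe_filter, Finset.mem_Icc, T]
    constructor
    · rintro ⟨h1, h2⟩
      exact ⟨⟨(mem_closure_Icc hA N h1).1, Nat.le_floor h2⟩, h1⟩
    · rintro ⟨⟨_, h2⟩, h1⟩
      exact ⟨h1, (Nat.le_floor_iff hx0.le).1 h2⟩
  have hTS : ∀ m ∈ T, m ∈ (Submonoid.closure (S : Set ℕ) : Set ℕ) := by
    intro m hm
    simp only [T, Finset.mem_filter, Finset.mem_Icc] at hm
    rw [hS]
    exact (mem_closure_Icc hA N hm.2).2 hm.1.2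
  have hsumT : ∑ m ∈ T, (m : ℝ) ^ (-σ) ≤ Real.exp (K / (1 - 2 ^ (-σ))) := by
    rw [← ENNReal.ofReal_le_ofReal_iff (Real.exp_pos _).le,
      ENNReal.ofReal_sum_of_nonneg fun _ _ => by positivity]
    calc ∑ m ∈ T, ENNReal.ofReal ((m : ℝ) ^ (-σ))
        = ∑' m : (T : Set ℕ), ENNReal.ofReal (((m : ℕ) : ℝ) ^ (-σ)) :=
          (Finset.tsum_subtype' T fun m : ℕ => ENNReal.ofReal ((m : ℝ) ^ (-σ))).symm
      _ ≤ ∑' m : (Submonoid.closure (S : Set ℕ) : Set ℕ),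
            ENNReal.ofReal (((m : ℕ) : ℝ) ^ (-σ)) :=
          ENNReal.tsum_mono_subtype (fun m : ℕ => ENNReal.ofReal ((m : ℝ) ^ (-σ))) hTS
      _ ≤ _ := tsum_closure_le_prod σ S
      _ ≤ _ := prod_inv_one_sub_le hσ S fun a ha => by
          simp only [S, Finset.mem_filter, Finset.mem_Icc] at ha
          exact ha.1.1
      _ ≤ _ := by
          have h1 : 0 < 1 - (2 : ℝ) ^ (-σ) := by linarith
          have h2 : ∑ a ∈ S, (a : ℝ) ^ (-σ) ≤ K := by
            rw [Finset.sum_congr rfl (g := A.indicator fun n : ℕ => (n : ℝ) ^ (-σ))]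
            · exact hsum.sum_le_tsum S fun n _ => Set.indicator_nonneg (fun _ _ => by positivity) n
            · intro a ha
              rw [Set.indicator_of_mem (Finset.mem_filter.1 ha).2]
          gcongr
  have hcard : (T.card : ℝ) * x ^ (-σ) ≤ ∑ m ∈ T, (m : ℝ) ^ (-σ) := by
    rw [← nsmul_eq_mul]
    refine Finset.card_nsmul_le_sum _ _ _ fun m hm => ?_
    simp only [T, Finset.mem_filter, Finset.mem_Icc] at hm
    exact Real.rpow_le_rpow_of_nonpos (by exact_mod_cast hm.1.1)
      ((Nat.le_floor_iff hx0.le).1 hm.1.2) (by linarith)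
  have hpos : 0 < x ^ σ := by positivity
  rw [count, hT, Set.ncard_coe_finset]
  rw [Real.rpow_neg hx0.le, ← div_eq_mul_inv, div_le_iff₀ hpos] at hcard
  exact hcard.trans (by gcongr)

lemma summable_indicator_union {f : ℕ → ℝ} (hf : ∀ n, 0 ≤ f n) {A B : Set ℕ}
    (hA : Summable (A.indicator f)) (hB : Summable (B.indicator f)) :
    Summable ((A ∪ B).indicator f) := by
  refine (hA.add hB).of_nonneg_of_le (Set.indicator_nonneg fun n _ => hf n) fun n => ?_
  have := hf n
  by_cases h1 : n ∈ A <;> by_cases h2 : n ∈ B <;> simp [h1, h2, this]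

/-- Comparison of `∑ n ^ (-σ)` over integers `n = 2 ^ t * g` with a product of a geometric
series in `t` and a convergent series in `g`. -/
lemma summable_indicator_of_two_pow_mul {A : Set ℕ} {ε C : ℝ} (hε : 0 < ε) {h : ℕ → ℝ}
    (h0 : ∀ g, 0 ≤ h g) (hh : Summable h)
    (hA : ∀ n ∈ A, ∃ g t : ℕ, 0 < g ∧ n = 2 ^ t * g ∧
      (2 : ℝ) ^ (-(t * (8 / 11 : ℝ))) * (g : ℝ) ^ (-(8 / 11 + ε)) ≤ C * h g) :
    Summable (A.indicator fun n : ℕ => (n : ℝ) ^ (-(8 / 11 + ε))) := by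
  rw [← summable_subtype_iff_indicator]
  choose! g t hg hn hle using hA
  have hr : (2 : ℝ) ^ (-ε) < 1 := Real.rpow_lt_one_of_one_lt_of_neg (by norm_num) (by linarith)
  have hprod : Summable fun p : ℕ × ℕ => ((2 : ℝ) ^ (-ε)) ^ p.1 * h p.2 :=
    (summable_geometric_of_lt_one (by positivity) hr).mul_of_nonneg hh
      (fun _ => by positivity) h0
  have hinj : Function.Injective fun n : A => (t n, g n) := by
    intro m n hmn
    simp only [Prod.mk.injEq] at hmn
    exact Subtype.ext (by rw [hn m m.2, hn n n.2, hmn.1, hmn.2])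
  refine ((hprod.comp_injective hinj).mul_left C).of_nonneg_of_le
    (fun n => by simp only [Function.comp_apply]; positivity) fun n => ?_
  have hcast : ((n : ℕ) : ℝ) = 2 ^ (t n : ℝ) * (g n : ℝ) := by
    rw [Real.rpow_natCast]
    exact_mod_cast hn n n.2
  simp only [Function.comp_apply]
  rw [hcast, Real.mul_rpow (by positivity) (by positivity), ← Real.rpow_mul (by norm_num),
    show (t n : ℝ) * -(8 / 11 + ε) = -ε * t n + -(t n * (8 / 11 : ℝ)) by ring,
    Real.rpow_add (by norm_num), Real.rpow_mul (by norm_num), Real.rpow_natCast, mul_assoc,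
    mul_left_comm C]
  exact mul_le_mul_of_nonneg_left (hle n n.2) (by positivity)

lemma summable_G₂ {ε : ℝ} (hε : 0 < ε) :
    Summable (G₂.indicator fun n : ℕ => (n : ℝ) ^ (-(8 / 11 + ε))) := by
  refine summable_indicator_of_two_pow_mul (C := 2 ^ (40 / 11 : ℝ)) hε
    (h := fun g => (g : ℝ) ^ (-(1 + ε))) (fun _ => by positivity)
    (Real.summable_nat_rpow.2 (by linarith)) ?_
  rintro n ⟨g, t, hodd, hg, ht, rfl⟩
  refine ⟨g, t, hg, rfl, ?_⟩
  have hg0 : (0 : ℝ) < g := by exact_mod_cast hg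
  have hL : Real.logb 2 g - 2 ≤ Real.logb 2 (((g : ℝ) - 1) / 2) := by
    obtain rfl | h1 := eq_or_ne g 1
    · simp
    · have h3 : (3 : ℝ) ≤ g := by
        have : 3 ≤ g := by obtain ⟨k, rfl⟩ := hodd; omega
        exact_mod_cast this
      have h4 : Real.logb 2 4 = 2 := by
        rw [show (4 : ℝ) = 2 ^ (2 : ℝ) by norm_num, Real.logb_rpow (by norm_num) (by norm_num)]
      have h5 : Real.logb 2 (g / 4) = Real.logb 2 g - 2 := by
        rw [Real.logb_div hg0.ne' (by norm_num), h4]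
      rw [← h5]
      exact Real.logb_le_logb_of_le (by norm_num) (by positivity) (by linarith)
  have hfl := Int.lt_floor_add_one (Real.logb 2 (((g : ℝ) - 1) / 2) / 16)
  have ht' : 6 * (⌊Real.logb 2 (((g : ℝ) - 1) / 2) / 16⌋ : ℝ) + 2 ≤ t := by exact_mod_cast ht
  have hgL : (2 : ℝ) ^ (Real.logb 2 g) = g := Real.rpow_logb (by norm_num) (by norm_num) hg0
  set L := Real.logb 2 g
  rw [← hgL, ← Real.rpow_mul (by norm_num), ← Real.rpow_mul (by norm_num),
    ← Real.rpow_add (by norm_num), ← Real.rpow_add (by norm_num)]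
  refine Real.rpow_le_rpow_of_exponent_le (by norm_num) ?_
  linarith

lemma s₂_two_mul (g : ℕ) : s₂ (2 * g) = s₂ g := by
  obtain rfl | hg := Nat.eq_zero_or_pos g
  · rfl
  · have := Nat.digits_add 2 (by norm_num) 0 g (by norm_num) (Or.inr hg.ne')
    rw [zero_add] at this
    simp [s₂, this]

lemma s₂_two_mul_add_one (g : ℕ) : s₂ (2 * g + 1) = s₂ g + 1 := by
  have := Nat.digits_add 2 (by norm_num) 1 g (by norm_num) (Or.inl (by norm_num))
  rw [add_comm] at this
  rw [s₂, s₂, this, List.count_cons_self]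

lemma two_rpow_neg_le : (2 : ℝ) ^ (-(8 / 11 : ℝ)) ≤ 5 / 8 := by
  refine le_of_pow_le_pow_left₀ (n := 11) (by norm_num) (by norm_num) ?_
  rw [← Real.rpow_natCast, ← Real.rpow_mul (by norm_num)]
  norm_num

lemma four_rpow_neg_le : (4 : ℝ) ^ (-(8 / 11 : ℝ)) ≤ 2 / 5 := by
  refine le_of_pow_le_pow_left₀ (n := 11) (by norm_num) (by norm_num) ?_
  rw [← Real.rpow_natCast, ← Real.rpow_mul (by norm_num)]
  norm_num

lemma sum_range_two_mul (f : ℕ → ℝ) (N : ℕ) :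
    ∑ g ∈ range (2 * N), f g = ∑ g ∈ range N, (f (2 * g) + f (2 * g + 1)) := by
  induction N with
  | zero => simp
  | succ N ih => rw [mul_add, mul_one, sum_range_succ, sum_range_succ, sum_range_succ, ih]; ring

lemma summable_s₂ :
    Summable fun g : ℕ => ((4 : ℝ) ^ (-(8 / 11 : ℝ))) ^ s₂ g * (g : ℝ) ^ (-(8 / 11 : ℝ)) := by
  set F := fun g : ℕ => ((4 : ℝ) ^ (-(8 / 11 : ℝ))) ^ s₂ g * (g : ℝ) ^ (-(8 / 11 : ℝ)) with hF
  have hF0 : ∀ g, 0 ≤ F g := fun g => by positivity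
  have heven : ∀ g, F (2 * g) ≤ 5 / 8 * F g := by
    intro g
    simp only [hF]
    rw [s₂_two_mul, Nat.cast_mul, Real.mul_rpow (by positivity) (by positivity), mul_left_comm]
    refine mul_le_mul_of_nonneg_right ?_ (hF0 g)
    exact_mod_cast two_rpow_neg_le
  have hodd : ∀ g, F (2 * g + 1) ≤ 1 / 4 * F g + if g = 0 then 1 else 0 := by
    intro g
    split_ifs with hg
    · subst hg
      have h1 : F (2 * 0 + 1) ≤ 2 / 5 := by
        simpa [hF, s₂] using four_rpow_neg_le
      linarith [hF0 0]
    · have hle : ((2 * g + 1 : ℕ) : ℝ) ^ (-(8 / 11 : ℝ)) ≤ 5 / 8 * (g : ℝ) ^ (-(8 / 11 : ℝ)) := by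
        calc ((2 * g + 1 : ℕ) : ℝ) ^ (-(8 / 11 : ℝ)) ≤ (2 * (g : ℝ)) ^ (-(8 / 11 : ℝ)) :=
              Real.rpow_le_rpow_of_nonpos (by positivity) (by push_cast; linarith) (by norm_num)
          _ = 2 ^ (-(8 / 11 : ℝ)) * (g : ℝ) ^ (-(8 / 11 : ℝ)) :=
              Real.mul_rpow (by norm_num) (by positivity)
          _ ≤ _ := by gcongr; exact two_rpow_neg_le
      calc F (2 * g + 1)
          = ((4 : ℝ) ^ (-(8 / 11 : ℝ))) ^ s₂ g * (4 : ℝ) ^ (-(8 / 11 : ℝ)) *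
              ((2 * g + 1 : ℕ) : ℝ) ^ (-(8 / 11 : ℝ)) := by
            simp only [hF]
            rw [s₂_two_mul_add_one, pow_succ]
        _ ≤ ((4 : ℝ) ^ (-(8 / 11 : ℝ))) ^ s₂ g * (2 / 5) *
              (5 / 8 * (g : ℝ) ^ (-(8 / 11 : ℝ))) := by
            gcongr
            exact four_rpow_neg_le
        _ = 1 / 4 * F g + 0 := by simp only [hF]; ring
  refine summable_of_sum_range_le (c := 8) hF0 fun N => ?_
  induction N using Nat.strong_induction_on with
  | _ N ih =>
    obtain hN | hN := Nat.lt_or_ge N 2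
    · calc ∑ g ∈ range N, F g ≤ ∑ g ∈ range 1, F g :=
            sum_le_sum_of_subset_of_nonneg (range_mono (by omega)) fun g _ _ => hF0 g
        _ ≤ 8 := by simp [hF, Real.zero_rpow]
    · set M := (N + 1) / 2
      have hind : ∑ g ∈ range M, (if g = 0 then (1 : ℝ) else 0) ≤ 1 := by
        rw [sum_ite_eq']
        split_ifs <;> norm_num
      calc ∑ g ∈ range N, F g ≤ ∑ g ∈ range (2 * M), F g :=
            sum_le_sum_of_subset_of_nonneg (range_mono (by omega)) fun g _ _ => hF0 g
        _ = ∑ g ∈ range M, (F (2 * g) + F (2 * g + 1)) := sum_range_two_mul F M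
        _ ≤ ∑ g ∈ range M, (7 / 8 * F g + if g = 0 then 1 else 0) :=
            sum_le_sum fun g _ => by linarith [heven g, hodd g]
        _ ≤ 7 / 8 * 8 + 1 := by
            rw [sum_add_distrib, ← mul_sum]
            linarith [ih M (by omega)]
        _ = 8 := by norm_num

lemma summable_G₃ {ε : ℝ} (hε : 0 < ε) :
    Summable (G₃.indicator fun n : ℕ => (n : ℝ) ^ (-(8 / 11 + ε))) := by
  refine summable_indicator_of_two_pow_mul (C := 2 ^ (8 / 11 : ℝ)) hε
    (fun _ => by positivity) summable_s₂ ?_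
  rintro n ⟨g, t, hodd, hg, h1, h3, rfl⟩
  refine ⟨g, t, hg, rfl, ?_⟩
  have ht : 2 * s₂ g ≤ t + 1 := by
    obtain ⟨k, rfl⟩ := hodd
    omega
  have ht' : 2 * (s₂ g : ℝ) ≤ t + 1 := by exact_mod_cast ht
  have hg1 : (1 : ℝ) ≤ g := by exact_mod_cast hg
  rw [← mul_assoc]
  refine mul_le_mul ?_ (Real.rpow_le_rpow_of_exponent_le hg1 (by linarith)) (by positivity)
    (by positivity)
  rw [show (4 : ℝ) = 2 ^ (2 : ℝ) by norm_num, ← Real.rpow_natCast, ← Real.rpow_mul (by norm_num),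
    ← Real.rpow_mul (by norm_num), ← Real.rpow_add (by norm_num)]
  refine Real.rpow_le_rpow_of_exponent_le (by norm_num) ?_
  linarith

lemma summable_Qsq {σ : ℝ} (hσ : 1 / 2 < σ) :
    Summable (Qsq.indicator fun n : ℕ => (n : ℝ) ^ (-σ)) := by
  rw [← summable_subtype_iff_indicator]
  have hQ : ∀ n ∈ Qsq, ∃ m : ℕ, n = m ^ 2 := fun n ⟨m, _, h⟩ => ⟨m, h⟩
  choose! m hm using hQ
  have hinj : Function.Injective fun n : Qsq => m n := fun a b hab =>
    Subtype.ext (by rw [hm a a.2, hm b b.2]; exact congrArg (· ^ 2) hab)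
  refine ((Real.summable_nat_rpow.2 (by linarith : -(2 * σ) < -1)).comp_injective hinj).congr
    fun n => ?_
  have hcast : ((n : ℕ) : ℝ) = (m n : ℝ) ^ (2 : ℝ) := by
    rw [Real.rpow_ofNat]
    exact_mod_cast hm n n.2
  simp only [Function.comp_apply]
  rw [hcast, ← Real.rpow_mul (by positivity)]
  ring_nf

end MonoidCount

theorem other_constructions_monoid_count (F : Finset ℕ) (hF : ∀ n ∈ F, 0 < n) :
    ∀ ε : ℝ, ε > 0 → ∃ c : ℝ, c > 0 ∧ ∃ x₀ : ℝ, ∀ x : ℝ, x ≥ x₀ →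
      (count (↑(Submonoid.closure ((↑F : Set ℕ) ∪ G₂ ∪ G₃ ∪ Qsq))) x : ℝ)
        ≤ c * x ^ ((8 : ℝ) / 11 + ε) := by
  intro ε hε
  have hpos : ∀ n : ℕ, 0 ≤ (n : ℝ) ^ (-(8 / 11 + ε)) := fun n => by positivity
  have hA : ∀ n ∈ (↑F : Set ℕ) ∪ G₂ ∪ G₃ ∪ Qsq, 0 < n := by
    rintro n (((hn | ⟨g, t, -, hg, -, rfl⟩) | ⟨g, t, -, hg, -, -, rfl⟩) | ⟨m, hm, rfl⟩)
    · exact hF n hn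
    all_goals positivity
  obtain ⟨c, hc, h⟩ := MonoidCount.exists_count_closure_le hA
    (σ := 8 / 11 + ε) (by linarith)
    (MonoidCount.summable_indicator_union hpos (MonoidCount.summable_indicator_union hpos
      (MonoidCount.summable_indicator_union hpos
        (summable_of_hasFiniteSupport (F.finite_toSet.subset Set.support_indicator_subset))
        (MonoidCount.summable_G₂ hε)) (MonoidCount.summable_G₃ hε))
      (MonoidCount.summable_Qsq (by linarith)))
  exact ⟨c, hc, 1, h⟩
end

section
/- Let 𝒜, ℬ be (multiplicative) monoids of natural numbers and let 𝒞 = 𝒜ℬ. Suppose there is a constant c₁ > 0 such that for every positive integer x, Σ_{k=1}^{⌈log₂ x⌉} (b(x/2^{k−1}) + b(x/2^k)) · ā(2^k) ≤ c₁ · b(x), where b(y) = #(ℬ ∩ (y/2, y]) and ā(y) = #(𝒜 ∩ [y/2, y]). Then C(x) = Θ(B(x)): indeed B(x) ≤ C(x) ≤ c₁·B(x) for all positive integers x. -/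
/-- A (multiplicative) monoid of natural numbers: a set of positive integers
containing `1` and closed under multiplication. -/
def IsNatMonoid (A : Set ℕ) : Prop :=
  (∀ a ∈ A, 0 < a) ∧ 1 ∈ A ∧ ∀ a ∈ A, ∀ b ∈ A, a * b ∈ A

/-- The dyadic-interval count `x̲(y) = #(𝒳 ∩ (y/2, y])`. -/
noncomputable def dyadic (X : Set ℕ) (y : ℝ) : ℕ :=
  {n : ℕ | n ∈ X ∧ y / 2 < (n : ℝ) ∧ (n : ℝ) ≤ y}.ncard

/-- The closed dyadic-interval count `x̄(y) = #(𝒳 ∩ [y/2, y])`. -/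
noncomputable def dyadicBar (X : Set ℕ) (y : ℝ) : ℕ :=
  {n : ℕ | n ∈ X ∧ y / 2 ≤ (n : ℝ) ∧ (n : ℝ) ≤ y}.ncard

theorem finite_setOf_mem_and_cast_le (A : Set ℕ) (x : ℝ) :
    {n : ℕ | n ∈ A ∧ (n : ℝ) ≤ x}.Finite :=
  (Set.finite_Iic ⌊x⌋₊).subset fun _ hn => Nat.le_floor hn.2

theorem finite_setOf_mem_dyadic (A : Set ℕ) (x : ℝ) :
    {n : ℕ | n ∈ A ∧ x / 2 < (n : ℝ) ∧ (n : ℝ) ≤ x}.Finite :=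
  (finite_setOf_mem_and_cast_le A x).subset fun _ hn => ⟨hn.1, hn.2.2⟩

theorem finite_setOf_mem_dyadicBar (A : Set ℕ) (x : ℝ) :
    {n : ℕ | n ∈ A ∧ x / 2 ≤ (n : ℝ) ∧ (n : ℝ) ≤ x}.Finite :=
  (finite_setOf_mem_and_cast_le A x).subset fun _ hn => ⟨hn.1, hn.2.2⟩

theorem count_eq_dyadic_add_count_half (X : Set ℕ) (x : ℕ) :
    count X (x : ℝ) = dyadic X (x : ℝ) + count X ((x / 2 : ℕ) : ℝ) := by
  unfold count dyadic
  rw [← Set.ncard_union_eq ?_ (finite_setOf_mem_dyadic X x) (finite_setOf_mem_and_cast_le X _)]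
  · congr 1
    ext n
    have h2 : (x : ℝ) / 2 < n ↔ x < n * 2 := by
      rw [div_lt_iff₀ two_pos]; norm_cast
    simp only [Set.mem_union, Set.mem_ofPred_eq, h2, Nat.cast_le]
    constructor
    · rintro ⟨hn, hx⟩
      rcases lt_or_ge x (n * 2) with h | h
      · exact Or.inl ⟨hn, h, hx⟩
      · exact Or.inr ⟨hn, by omega⟩
    · rintro (⟨hn, -, hx⟩ | ⟨hn, hx⟩)
      · exact ⟨hn, hx⟩
      · exact ⟨hn, by omega⟩
  · rw [Set.disjoint_left]
    rintro n ⟨-, h, -⟩ ⟨-, h'⟩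
    have h2 : x < n * 2 := by
      rw [div_lt_iff₀ two_pos] at h; exact_mod_cast h
    have h3 : n ≤ x / 2 := by exact_mod_cast h'
    omega

theorem exists_dyadic_scale {a x : ℕ} (ha : 0 < a) (hax : a ≤ x) (hx : 2 ≤ x) :
    ∃ k ∈ Finset.Icc 1 (Nat.clog 2 x), 2 ^ (k - 1) ≤ a ∧ a ≤ 2 ^ k := by
  have hx1 : 1 ≤ Nat.clog 2 x := Nat.clog_pos one_lt_two hx
  rcases Nat.lt_or_ge 1 a with h | h
  · have ha1 : 1 ≤ Nat.clog 2 a := Nat.clog_pos one_lt_two h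
    refine ⟨Nat.clog 2 a, Finset.mem_Icc.2 ⟨ha1, Nat.clog_mono_right 2 hax⟩, ?_,
      Nat.le_pow_clog one_lt_two a⟩
    exact (Nat.pow_pred_clog_lt_self one_lt_two h).le
  · obtain rfl : a = 1 := by omega
    exact ⟨1, Finset.mem_Icc.2 ⟨le_rfl, hx1⟩, by norm_num, by norm_num⟩

theorem dyadic_image2_mul_le (A B : Set ℕ) (hA : ∀ a ∈ A, 0 < a) {x : ℕ} (hx : 2 ≤ x) :
    dyadic (Set.image2 (· * ·) A B) (x : ℝ) ≤
      ∑ k ∈ Finset.Icc 1 (Nat.clog 2 x),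
        (dyadic B ((x : ℝ) / 2 ^ (k - 1)) + dyadic B ((x : ℝ) / 2 ^ k)) *
          dyadicBar A ((2 : ℝ) ^ k) := by
  classical
  let S (y : ℝ) : Finset ℕ := (finite_setOf_mem_dyadic B y).toFinset
  let T (y : ℝ) : Finset ℕ := (finite_setOf_mem_dyadicBar A y).toFinset
  have hS (y : ℝ) : dyadic B y = (S y).card := Set.ncard_eq_toFinset_card _ _
  have hT (y : ℝ) : dyadicBar A y = (T y).card := Set.ncard_eq_toFinset_card _ _
  let U : Finset ℕ := (Finset.Icc 1 (Nat.clog 2 x)).biUnion fun k =>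
    Finset.image₂ (· * ·) (S ((x : ℝ) / 2 ^ (k - 1)) ∪ S ((x : ℝ) / 2 ^ k)) (T ((2 : ℝ) ^ k))
  have hsub : {n : ℕ | n ∈ Set.image2 (· * ·) A B ∧ (x : ℝ) / 2 < n ∧ (n : ℝ) ≤ x} ⊆
      (U : Set ℕ) := by
    rintro n ⟨⟨a, ha, b, hb, rfl⟩, hlt, hle⟩
    have hpos := hA a ha
    simp only [Nat.cast_mul] at hlt hle
    have hbpos : 0 < b := by
      rcases Nat.eq_zero_or_pos b with rfl | h
      · have : (0 : ℝ) ≤ x := Nat.cast_nonneg x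
        simp only [Nat.cast_zero, mul_zero] at hlt
        linarith
      · exact h
    have hax : a ≤ x := (Nat.le_mul_of_pos_right a hbpos).trans (by exact_mod_cast hle)
    obtain ⟨k, hk, hka, hak⟩ := exists_dyadic_scale hpos hax hx
    have hka' : (2 : ℝ) ^ (k - 1) ≤ a := by exact_mod_cast hka
    have hak' : (a : ℝ) ≤ 2 ^ k := by exact_mod_cast hak
    have hpow : (2 : ℝ) ^ k = 2 * 2 ^ (k - 1) := by
      rw [← pow_succ', Nat.sub_add_cancel (Finset.mem_Icc.1 hk).1]
    have hp : (0 : ℝ) < 2 ^ (k - 1) := by positivity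
    have hb0 : (0 : ℝ) ≤ b := Nat.cast_nonneg b
    refine Finset.mem_coe.2 (Finset.mem_biUnion.2 ⟨k, hk, Finset.mem_image₂.2
      ⟨b, ?_, a, ?_, Nat.mul_comm b a⟩⟩)
    · have hup : (b : ℝ) ≤ x / 2 ^ (k - 1) := by
        rw [le_div_iff₀ hp]; nlinarith
      have hlow : (x : ℝ) / 2 ^ k / 2 < b := by
        rw [div_div, div_lt_iff₀ (by positivity)]; nlinarith
      have hhalf : (x : ℝ) / 2 ^ (k - 1) / 2 = x / 2 ^ k := by
        rw [hpow, div_div, mul_comm]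
      simp only [S, Finset.mem_union, Set.Finite.mem_toFinset, Set.mem_ofPred_eq]
      rcases lt_or_ge ((x : ℝ) / 2 ^ k) b with h | h
      · exact Or.inl ⟨hb, hhalf ▸ h, hup⟩
      · exact Or.inr ⟨hb, hlow, h⟩
    · simp only [T, Set.Finite.mem_toFinset, Set.mem_ofPred_eq]
      exact ⟨ha, by linarith, hak'⟩
  calc dyadic (Set.image2 (· * ·) A B) (x : ℝ)
      ≤ U.card := by
        rw [← Set.ncard_coe_finset]
        exact Set.ncard_le_ncard hsub U.finite_toSet
    _ ≤ _ := Finset.card_biUnion_le.trans (Finset.sum_le_sum fun k _ => by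
        rw [hS, hS, hT]
        exact (Finset.card_image₂_le _ _ _).trans
          (Nat.mul_le_mul_right _ (Finset.card_union_le _ _)))

theorem count_zero_of_pos {X : Set ℕ} (hX : ∀ n ∈ X, 0 < n) : count X (0 : ℝ) = 0 := by
  have : {n : ℕ | n ∈ X ∧ (n : ℝ) ≤ 0} = ∅ := by
    ext n
    simp only [Set.mem_ofPred_eq, Set.mem_empty_iff_false, iff_false, not_and, not_le]
    exact fun hn => by exact_mod_cast hX n hn
  rw [count, this, Set.ncard_empty]

theorem count_one_of_pos {X : Set ℕ} (hX : ∀ n ∈ X, 0 < n) (h1 : 1 ∈ X) :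
    count X (1 : ℝ) = 1 := by
  have : {n : ℕ | n ∈ X ∧ (n : ℝ) ≤ 1} = {1} := by
    ext n
    simp only [Set.mem_ofPred_eq, Set.mem_singleton_iff, Nat.cast_le_one]
    constructor
    · rintro ⟨hn, hle⟩
      exact le_antisymm hle (hX n hn)
    · rintro rfl
      exact ⟨h1, le_rfl⟩
  rw [count, this, Set.ncard_singleton]

theorem dyadic_two_le_one (X : Set ℕ) : dyadic X (2 : ℝ) ≤ 1 := by
  refine (Set.ncard_le_ncard (t := {2}) ?_).trans (Set.ncard_singleton 2).le
  rintro n ⟨-, h1, h2⟩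
  have h1' : 1 < n := by rw [div_self two_ne_zero] at h1; exact_mod_cast h1
  have h2' : n ≤ 2 := by exact_mod_cast h2
  exact le_antisymm h2' h1'

theorem one_le_dyadic_one {X : Set ℕ} (h : 1 ∈ X) : 1 ≤ dyadic X (1 : ℝ) :=
  (Set.ncard_pos (finite_setOf_mem_dyadic X 1)).2 ⟨1, h, by norm_num, by norm_num⟩

theorem one_le_dyadicBar_two {X : Set ℕ} (h : 1 ∈ X) : 1 ≤ dyadicBar X (2 : ℝ) :=
  (Set.ncard_pos (finite_setOf_mem_dyadicBar X 2)).2 ⟨1, h, by norm_num, by norm_num⟩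


theorem product_count_theta (A B : Set ℕ)
    (hA : IsNatMonoid A) (hB : IsNatMonoid B) (c₁ : ℝ) (hc₁ : c₁ > 0)
    (h : ∀ x : ℕ, 0 < x →
      (∑ k ∈ Finset.Icc 1 (Nat.clog 2 x),
          ((dyadic B ((x : ℝ) / 2 ^ (k - 1)) : ℝ) + (dyadic B ((x : ℝ) / 2 ^ k) : ℝ)) *
            (dyadicBar A ((2 : ℝ) ^ k) : ℝ))
        ≤ c₁ * (dyadic B (x : ℝ) : ℝ)) :
    ∀ x : ℕ, 0 < x →
      (count B (x : ℝ) : ℝ) ≤ (count (Set.image2 (· * ·) A B) (x : ℝ) : ℝ) ∧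
      (count (Set.image2 (· * ·) A B) (x : ℝ) : ℝ) ≤ c₁ * (count B (x : ℝ) : ℝ) := by
  have hCpos : ∀ n ∈ Set.image2 (· * ·) A B, 0 < n := by
    rintro n ⟨a, ha, b, hb, rfl⟩
    exact Nat.mul_pos (hA.1 a ha) (hB.1 b hb)
  have hC1 : 1 ∈ Set.image2 (· * ·) A B := ⟨1, hA.2.1, 1, hB.2.1, one_mul 1⟩
  have hc : 1 ≤ c₁ := by
    have h2 := h 2 two_pos
    have hclog : Nat.clog 2 2 = 1 := by decide
    rw [hclog, Finset.Icc_self, Finset.sum_singleton] at h2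
    norm_num at h2
    have e1 : (dyadic B (2 : ℝ) : ℝ) ≤ 1 := by exact_mod_cast dyadic_two_le_one B
    have e2 : (1 : ℝ) ≤ dyadic B (1 : ℝ) := by exact_mod_cast one_le_dyadic_one hB.2.1
    have e3 : (1 : ℝ) ≤ dyadicBar A (2 : ℝ) := by exact_mod_cast one_le_dyadicBar_two hA.2.1
    have e4 : (0 : ℝ) ≤ dyadic B (2 : ℝ) := Nat.cast_nonneg _
    nlinarith
  have hupper : ∀ x : ℕ, (count (Set.image2 (· * ·) A B) (x : ℝ) : ℝ) ≤
      c₁ * (count B (x : ℝ) : ℝ) := by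
    intro x
    induction x using Nat.strong_induction_on with
    | _ x ih =>
      rcases Nat.lt_or_ge x 2 with hx | hx
      · interval_cases x
        · rw [Nat.cast_zero, count_zero_of_pos hCpos, count_zero_of_pos hB.1]
          simp
        · rw [Nat.cast_one, count_one_of_pos hCpos hC1, count_one_of_pos hB.1 hB.2.1]
          simpa using hc
      · have hd : (dyadic (Set.image2 (· * ·) A B) (x : ℝ) : ℝ) ≤ c₁ * dyadic B (x : ℝ) :=
          le_trans (by exact_mod_cast dyadic_image2_mul_le A B hA.1 hx) (h x (by omega))
        have hi := ih (x / 2) (by omega)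
        rw [count_eq_dyadic_add_count_half _ x, count_eq_dyadic_add_count_half B x]
        push_cast at hi ⊢
        linarith
  refine fun x _ => ⟨?_, hupper x⟩
  have hsub : {n : ℕ | n ∈ B ∧ (n : ℝ) ≤ x} ⊆
      {n : ℕ | n ∈ Set.image2 (· * ·) A B ∧ (n : ℝ) ≤ x} :=
    fun n hn => ⟨⟨1, hA.2.1, n, hn.1, one_mul n⟩, hn.2⟩
  exact Nat.cast_le.2 (Set.ncard_le_ncard hsub (finite_setOf_mem_and_cast_le _ _))
end

section
/- Let α₀ ∈ (0,1), let x₀ ≥ 2, and let 𝒢 be a set of integers all of which are ≥ x₀, whose counting function satisfies G(x) ≤ (1/2)·x^{α₀} for all x ≥ x₀. Let 𝓜 be the multiplicative monoid generated by 𝒢. Then for every real α₁ > α₀, M(x) = O(x^{α₁}). -/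
theorem pos_of_mem_closure {A : Set ℕ} (hA : ∀ a ∈ A, 0 < a) {m : ℕ}
    (hm : m ∈ Submonoid.closure A) : 0 < m := by
  induction hm using Submonoid.closure_induction with
  | mem a ha => exact hA a ha
  | one => exact one_pos
  | mul a b _ _ iha ihb => exact Nat.mul_pos iha ihb

theorem mem_closure_of_mem_closure_of_le {A : Set ℕ} (hA : ∀ a ∈ A, 0 < a) {m N : ℕ}
    (hm : m ∈ Submonoid.closure A) (hmN : m ≤ N) :
    m ∈ Submonoid.closure {a | a ∈ A ∧ a ≤ N} := by
  induction hm using Submonoid.closure_induction with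
  | mem a ha => exact Submonoid.subset_closure ⟨ha, hmN⟩
  | one => exact one_mem _
  | mul a b ha hb iha ihb =>
    exact mul_mem (iha ((Nat.le_mul_of_pos_right a (pos_of_mem_closure hA hb)).trans hmN))
      (ihb ((Nat.le_mul_of_pos_left b (pos_of_mem_closure hA ha)).trans hmN))

theorem mem_closure_insert_or {A : Set ℕ} {g m : ℕ}
    (hm : m ∈ Submonoid.closure (insert g A)) :
    m ∈ Submonoid.closure A ∨ ∃ k ∈ Submonoid.closure (insert g A), m = g * k := by
  induction hm using Submonoid.closure_induction with
  | mem a ha =>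
    rcases ha with rfl | ha
    · exact Or.inr ⟨1, one_mem _, (mul_one _).symm⟩
    · exact Or.inl (Submonoid.subset_closure ha)
  | one => exact Or.inl (one_mem _)
  | mul a b ha hb iha ihb =>
    rcases iha with iha | ⟨k, hk, rfl⟩
    · rcases ihb with ihb | ⟨k, hk, rfl⟩
      · exact Or.inl (mul_mem iha ihb)
      · exact Or.inr ⟨a * k, mul_mem ha hk, by ring⟩
    · exact Or.inr ⟨k * b, mul_mem hk hb, by ring⟩

theorem count_closure_insert_le (A : Set ℕ) {g : ℕ} (hg : 0 < g) (x : ℝ) :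
    count (Submonoid.closure (insert g A)) x ≤
      count (Submonoid.closure A) x + count (Submonoid.closure (insert g A)) (x / g) := by
  have hg' : (0 : ℝ) < g := by exact_mod_cast hg
  unfold count
  have hfin := finite_setOf_mem_and_cast_le (Submonoid.closure (insert g A)) (x / g)
  refine (Set.ncard_le_ncard (t := {n : ℕ | n ∈ (Submonoid.closure A : Set ℕ) ∧ (n : ℝ) ≤ x} ∪
      (fun k => g * k) '' {n : ℕ | n ∈ (Submonoid.closure (insert g A) : Set ℕ) ∧
        (n : ℝ) ≤ x / g}) ?_ ((finite_setOf_mem_and_cast_le _ _).union (hfin.image _))).trans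
    ((Set.ncard_union_le _ _).trans (Nat.add_le_add_left (Set.ncard_image_le hfin) _))
  rintro m ⟨hm, hmx⟩
  rcases mem_closure_insert_or hm with h | ⟨k, hk, rfl⟩
  · exact Or.inl ⟨h, hmx⟩
  · refine Or.inr ⟨k, ⟨hk, ?_⟩, rfl⟩
    rw [le_div_iff₀ hg']
    push_cast at hmx
    linarith

theorem count_closure_eq_zero {A : Set ℕ} (hA : ∀ a ∈ A, 0 < a) {x : ℝ} (hx : x < 1) :
    count (Submonoid.closure A) x = 0 := by
  unfold count
  convert Set.ncard_empty ℕ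
  refine Set.eq_empty_of_forall_notMem ?_
  rintro m ⟨hm, hmx⟩
  have : (1 : ℝ) ≤ m := by exact_mod_cast pos_of_mem_closure hA hm
  linarith

theorem natCast_rpow_neg_lt_one {g : ℕ} (hg : 2 ≤ g) {s : ℝ} (hs : 0 < s) :
    (g : ℝ) ^ (-s) < 1 :=
  Real.rpow_lt_one_of_one_lt_of_neg (by exact_mod_cast hg) (by linarith)

/-- Rankin's bound for a finitely generated monoid, with the Euler product as the constant. -/
theorem count_closure_finset_le {s : ℝ} (hs : 0 < s) (F : Finset ℕ) (hF : ∀ g ∈ F, 2 ≤ g)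
    {x : ℝ} (hx : 0 ≤ x) :
    (count (Submonoid.closure (F : Set ℕ)) x : ℝ) ≤
      (∏ g ∈ F, (1 - (g : ℝ) ^ (-s))⁻¹) * x ^ s := by
  induction F using Finset.induction_on generalizing x with
  | empty =>
    rcases lt_or_ge x 1 with h | h
    · rw [count_closure_eq_zero (by simp) h]
      simpa using Real.rpow_nonneg hx s
    · have h1 : count (Submonoid.closure ((∅ : Finset ℕ) : Set ℕ)) x ≤ 1 := by
        unfold count
        refine (Set.ncard_le_ncard (t := {1}) ?_ (Set.finite_singleton _)).trans
          (Set.ncard_singleton _).le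
        rintro m ⟨hm, -⟩
        simpa using hm
      have h2 : (1 : ℝ) ≤ x ^ s := Real.one_le_rpow h hs.le
      have h3 : (count (Submonoid.closure ((∅ : Finset ℕ) : Set ℕ)) x : ℝ) ≤ 1 := by
        exact_mod_cast h1
      simpa using h3.trans h2
  | insert g F hgF ih =>
    have hg2 : 2 ≤ g := hF g (Finset.mem_insert_self _ _)
    have hF' : ∀ a ∈ F, 2 ≤ a := fun a ha => hF a (Finset.mem_insert_of_mem ha)
    have hg2' : (2 : ℝ) ≤ g := by exact_mod_cast hg2
    rw [Finset.prod_insert hgF]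
    set P := ∏ a ∈ F, (1 - (a : ℝ) ^ (-s))⁻¹
    have hP : 0 ≤ P := Finset.prod_nonneg fun a ha =>
      inv_nonneg.2 (sub_nonneg.2 (natCast_rpow_neg_lt_one (hF' a ha) hs).le)
    have ht : 0 < 1 - (g : ℝ) ^ (-s) := sub_pos.2 (natCast_rpow_neg_lt_one hg2 hs)
    have key : ∀ n : ℕ, ∀ y : ℝ, 0 ≤ y → y < 2 ^ n →
        (count (Submonoid.closure ((insert g F : Finset ℕ) : Set ℕ)) y : ℝ) ≤
          ((1 - (g : ℝ) ^ (-s))⁻¹ * P) * y ^ s := by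
      intro n
      induction n with
      | zero =>
        intro y hy hy1
        rw [count_closure_eq_zero (fun a ha => two_pos.trans_le (hF a ha)) (by simpa using hy1)]
        have := Real.rpow_nonneg hy s
        simp only [Nat.cast_zero]
        positivity
      | succ n ihn =>
        intro y hy hyn
        have h1 := ihn (y / g) (by positivity) (by
          rw [div_lt_iff₀ (by linarith)]
          calc y < 2 ^ n * 2 := by rwa [← pow_succ]
            _ ≤ 2 ^ n * g := by gcongr)
        have h2 := ih hF' hy
        have h3 := count_closure_insert_le (F : Set ℕ) (two_pos.trans_le hg2) y
        rw [← Finset.coe_insert] at h3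
        have h3' : (count (Submonoid.closure ((insert g F : Finset ℕ) : Set ℕ)) y : ℝ) ≤
            count (Submonoid.closure (F : Set ℕ)) y +
              count (Submonoid.closure ((insert g F : Finset ℕ) : Set ℕ)) (y / g) := by
          exact_mod_cast h3
        have h4 : (y / g) ^ s = y ^ s * (g : ℝ) ^ (-s) := by
          rw [Real.div_rpow hy (by linarith), Real.rpow_neg (by linarith), div_eq_mul_inv]
        rw [h4] at h1
        refine (h3'.trans (add_le_add h2 h1)).trans (le_of_eq ?_)
        field_simp
        ring
    obtain ⟨n, hn⟩ := pow_unbounded_of_one_lt x (one_lt_two (α := ℝ))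
    exact key n x hx hn

theorem sum_rpow_neg_le_of_count_le {G : Set ℕ} {α s : ℝ} (hα : 0 < α) (hs : 0 < s)
    (hG0 : ∀ g ∈ G, 0 < g) (hG : ∀ g ∈ G, (count G g : ℝ) ≤ (g : ℝ) ^ α)
    (F : Finset ℕ) (hF : ∀ g ∈ F, g ∈ G) :
    ∑ g ∈ F, (g : ℝ) ^ (-s) ≤ ∑ i ∈ Finset.range F.card, ((i + 1 : ℕ) : ℝ) ^ (-(s / α)) := by
  induction F using Finset.induction_on_max with
  | empty => simp
  | insert g F hlt ih =>
    have hgF : g ∉ F := fun h => lt_irrefl _ (hlt g h)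
    have hgG : g ∈ G := hF g (Finset.mem_insert_self _ _)
    have hg0 : (0 : ℝ) < g := by exact_mod_cast hG0 g hgG
    rw [Finset.sum_insert hgF, Finset.card_insert_of_notMem hgF, Finset.sum_range_succ, add_comm]
    refine add_le_add (ih fun a ha => hF a (Finset.mem_insert_of_mem ha)) ?_
    have hcard : F.card + 1 ≤ count G g := by
      rw [← Finset.card_insert_of_notMem hgF, ← Set.ncard_coe_finset]
      refine Set.ncard_le_ncard ?_ (finite_setOf_mem_and_cast_le G g)
      intro a ha
      refine ⟨hF a ha, ?_⟩
      rcases Finset.mem_insert.1 ha with rfl | h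
      · exact le_rfl
      · exact_mod_cast (hlt a h).le
    have hcard' : ((F.card + 1 : ℕ) : ℝ) ≤ (g : ℝ) ^ α :=
      le_trans (by exact_mod_cast hcard) (hG g hgG)
    calc (g : ℝ) ^ (-s) = ((g : ℝ) ^ α) ^ (-(s / α)) := by
          rw [← Real.rpow_mul hg0.le]
          congr 1
          field_simp
      _ ≤ ((F.card + 1 : ℕ) : ℝ) ^ (-(s / α)) :=
          Real.rpow_le_rpow_of_nonpos (by positivity) hcard'
            (neg_nonpos.2 (div_pos hs hα).le)

theorem inv_one_sub_le_exp {t b : ℝ} (ht : 0 ≤ t) (htb : t ≤ b) (hb : b < 1) :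
    (1 - t)⁻¹ ≤ Real.exp ((1 - b)⁻¹ * t) := by
  have h1 : 0 < 1 - t := by linarith
  have h2 : 0 < 1 - b := by linarith
  calc (1 - t)⁻¹ = (1 - t)⁻¹ * t + 1 := by field_simp; ring
    _ ≤ (1 - b)⁻¹ * t + 1 := by gcongr
    _ ≤ Real.exp ((1 - b)⁻¹ * t) := Real.add_one_le_exp _

theorem large_generators_monoid_count (α₀ : ℝ) (hα₀ : α₀ ∈ Set.Ioo (0 : ℝ) 1)
    (x₀ : ℝ) (hx₀ : 2 ≤ x₀) (G : Set ℕ) (hG : ∀ g ∈ G, x₀ ≤ (g : ℝ))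
    (hGcount : ∀ x : ℝ, x ≥ x₀ → (count G x : ℝ) ≤ 1 / 2 * x ^ α₀) :
    ∀ α₁ : ℝ, α₁ > α₀ → ∃ c : ℝ, c > 0 ∧ ∃ x₁ : ℝ, ∀ x : ℝ, x ≥ x₁ →
      (count (↑(Submonoid.closure G)) x : ℝ) ≤ c * x ^ α₁ := by
  intro s hs
  have hα : 0 < α₀ := hα₀.1
  have hs0 : 0 < s := hα.trans hs
  have hG2 : ∀ g ∈ G, 2 ≤ g := fun g hg => by exact_mod_cast hx₀.trans (hG g hg)
  have hG0 : ∀ g ∈ G, 0 < g := fun g hg => two_pos.trans_le (hG2 g hg)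
  have hcount : ∀ g ∈ G, (count G g : ℝ) ≤ (g : ℝ) ^ α₀ := fun g hg =>
    (hGcount g (hG g hg)).trans (by
      have : (0 : ℝ) ≤ (g : ℝ) ^ α₀ := by positivity
      linarith)
  have hsum : Summable fun i : ℕ => ((i + 1 : ℕ) : ℝ) ^ (-(s / α₀)) :=
    (summable_nat_add_iff 1).2 (Real.summable_nat_rpow.2 (neg_lt_neg ((one_lt_div hα).2 hs)))
  have hb : (2 : ℝ) ^ (-s) < 1 := by exact_mod_cast natCast_rpow_neg_lt_one le_rfl hs0
  have hb' : 0 ≤ (1 - (2 : ℝ) ^ (-s))⁻¹ := inv_nonneg.2 (sub_nonneg.2 hb.le)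
  refine ⟨Real.exp ((1 - (2 : ℝ) ^ (-s))⁻¹ * ∑' i : ℕ, ((i + 1 : ℕ) : ℝ) ^ (-(s / α₀))),
    Real.exp_pos _, 0, fun x hx => ?_⟩
  have hfin : {a | a ∈ G ∧ a ≤ ⌊x⌋₊}.Finite := (Set.finite_Iic ⌊x⌋₊).subset fun _ ha => ha.2
  have hFG : ∀ g ∈ hfin.toFinset, g ∈ G := fun g hg => (hfin.mem_toFinset.1 hg).1
  have hle : count (Submonoid.closure G) x ≤
      count (Submonoid.closure (hfin.toFinset : Set ℕ)) x := by
    refine Set.ncard_le_ncard ?_ (finite_setOf_mem_and_cast_le _ _)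
    rintro m ⟨hm, hmx⟩
    refine ⟨?_, hmx⟩
    rw [hfin.coe_toFinset]
    exact mem_closure_of_mem_closure_of_le hG0 hm (Nat.le_floor hmx)
  have hprod : ∏ g ∈ hfin.toFinset, (1 - (g : ℝ) ^ (-s))⁻¹ ≤
      Real.exp ((1 - (2 : ℝ) ^ (-s))⁻¹ * ∑' i : ℕ, ((i + 1 : ℕ) : ℝ) ^ (-(s / α₀))) := by
    calc ∏ g ∈ hfin.toFinset, (1 - (g : ℝ) ^ (-s))⁻¹
        ≤ ∏ g ∈ hfin.toFinset, Real.exp ((1 - (2 : ℝ) ^ (-s))⁻¹ * (g : ℝ) ^ (-s)) := by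
          refine Finset.prod_le_prod (fun g hg => inv_nonneg.2 (sub_nonneg.2
            (natCast_rpow_neg_lt_one (hG2 g (hFG g hg)) hs0).le)) fun g hg => ?_
          exact inv_one_sub_le_exp (by positivity)
            (Real.rpow_le_rpow_of_nonpos two_pos (by exact_mod_cast hG2 g (hFG g hg))
              (neg_nonpos.2 hs0.le)) hb
      _ = Real.exp ((1 - (2 : ℝ) ^ (-s))⁻¹ * ∑ g ∈ hfin.toFinset, (g : ℝ) ^ (-s)) := by
          rw [← Real.exp_sum, Finset.mul_sum]
      _ ≤ _ := by
          refine Real.exp_le_exp.2 (mul_le_mul_of_nonneg_left ?_ hb')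
          exact (sum_rpow_neg_le_of_count_le hα hs0 hG0 hcount _ hFG).trans
            (hsum.sum_le_tsum _ fun i _ => by positivity)
  calc (count (Submonoid.closure G) x : ℝ)
      ≤ count (Submonoid.closure (hfin.toFinset : Set ℕ)) x := by exact_mod_cast hle
    _ ≤ _ := count_closure_finset_le hs0 _ (fun g hg => hG2 g (hFG g hg)) hx
    _ ≤ _ := mul_le_mul_of_nonneg_right hprod (Real.rpow_nonneg hx s)
end
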